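/- Fix 0 < ε ≤ a, b, c ≤ K where b, c > 0. Define q₁(x) = -(ln x - ln c)/(x - c) for x ≠ c, extended by -1/c at x = c. Then q₁(a) - q₁(b) = L·(a - b) where L satisfies 1/(2K²) ≤ L ≤ 1/(2ε²). -/

import Mathlib

/-- A segment parametrized by `[0, 1]` stays in an interval containing its endpoints. -/
lemma segment_mem_Icc {l u c x t : ℝ} (hc : c ∈ Set.Icc l u) (hx : x ∈ Set.Icc l u)
    (ht : t ∈ Set.Icc (0 : ℝ) 1) : c + t * (x - c) ∈ Set.Icc l u := by
  obtain ⟨ht0, ht1⟩ := ht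
  constructor
  · nlinarith [mul_nonneg ht0 (sub_nonneg.2 hx.1),
      mul_nonneg (sub_nonneg.2 ht1) (sub_nonneg.2 hc.1)]
  · nlinarith [mul_nonneg ht0 (sub_nonneg.2 hx.2),
      mul_nonneg (sub_nonneg.2 ht1) (sub_nonneg.2 hc.2)]

lemma segment_pos {c x t : ℝ} (hc : 0 < c) (hx : 0 < x) (ht : t ∈ Set.Icc (0 : ℝ) 1) :
    0 < c + t * (x - c) :=
  (lt_min hc hx).trans_le (segment_mem_Icc (u := max c x) ⟨min_le_left _ _, le_max_left _ _⟩
    ⟨min_le_right _ _, le_max_right _ _⟩ ht).1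

lemma intervalIntegrable_inv_segment {c x : ℝ} (hc : 0 < c) (hx : 0 < x) :
    IntervalIntegrable (fun t : ℝ => (c + t * (x - c))⁻¹) MeasureTheory.volume 0 1 := by
  apply ContinuousOn.intervalIntegrable_of_Icc zero_le_one
  exact ContinuousOn.inv₀ (by fun_prop) fun t ht => (segment_pos hc hx ht).ne'

/-- The divided difference of the logarithm as the mean of `1 / y` over the segment. -/
lemma integral_inv_segment {c x : ℝ} (hc : 0 < c) (hx : 0 < x) :
    ∫ t in (0 : ℝ)..1, (c + t * (x - c))⁻¹ =
      if x = c then 1 / c else (Real.log x - Real.log c) / (x - c) := by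
  split_ifs with h
  · simp [h]
  · have hne : x - c ≠ 0 := sub_ne_zero.2 h
    rw [intervalIntegral.integral_eq_sub_of_hasDerivAt
      (f := fun t => Real.log (c + t * (x - c)) / (x - c)) _
      (intervalIntegrable_inv_segment hc hx)]
    · simp [sub_div]
    · intro t ht
      rw [Set.uIcc_of_le zero_le_one] at ht
      have hp := segment_pos hc hx ht
      have hd : HasDerivAt (fun t : ℝ => c + t * (x - c)) (x - c) t := by
        simpa using ((hasDerivAt_id t).mul_const (x - c)).const_add c
      have hlog := (hd.log hp.ne').div_const (x - c)
      rwa [div_right_comm, div_self hne, one_div] at hlog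

theorem stmt14 (ε K a b c : ℝ) (hε : 0 < ε)
    (hεa : ε ≤ a) (hεb : ε ≤ b) (hεc : ε ≤ c)
    (haK : a ≤ K) (hbK : b ≤ K) (hcK : c ≤ K)
    (q₁ : ℝ → ℝ)
    (hq₁ : q₁ = fun x => if x = c then -(1 / c)
      else -(Real.log x - Real.log c) / (x - c)) :
    ∃ L : ℝ, q₁ a - q₁ b = L * (a - b) ∧
      1 / (2 * K ^ 2) ≤ L ∧ L ≤ 1 / (2 * ε ^ 2) := by
  have ha : 0 < a := hε.trans_le hεa
  have hb : 0 < b := hε.trans_le hεb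
  have hc : 0 < c := hε.trans_le hεc
  have hq : ∀ x, 0 < x → q₁ x = -∫ t in (0 : ℝ)..1, (c + t * (x - c))⁻¹ := by
    intro x hx
    rw [integral_inv_segment hc hx, hq₁]
    dsimp only
    split_ifs <;> ring
  have hint : IntervalIntegrable
      (fun t : ℝ => t / ((c + t * (a - c)) * (c + t * (b - c)))) MeasureTheory.volume 0 1 := by
    apply ContinuousOn.intervalIntegrable_of_Icc zero_le_one
    exact ContinuousOn.div (by fun_prop) (by fun_prop) fun t ht =>
      (mul_pos (segment_pos hc ha ht) (segment_pos hc hb ht)).ne'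
  have hconst : ∀ m : ℝ, 1 / (2 * m ^ 2) = ∫ t in (0 : ℝ)..1, t / m ^ 2 := by
    intro m
    rw [intervalIntegral.integral_div, integral_id]
    simp [div_eq_mul_inv, mul_comm]
  refine ⟨∫ t in (0 : ℝ)..1, t / ((c + t * (a - c)) * (c + t * (b - c))), ?_, ?_, ?_⟩
  · rw [hq a ha, hq b hb, neg_sub_neg, ← intervalIntegral.integral_sub
      (intervalIntegrable_inv_segment hc hb) (intervalIntegrable_inv_segment hc ha),
      ← intervalIntegral.integral_mul_const]
    apply intervalIntegral.integral_congr
    intro t ht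
    rw [Set.uIcc_of_le zero_le_one] at ht
    have h₁ := (segment_pos hc ha ht).ne'
    have h₂ := (segment_pos hc hb ht).ne'
    dsimp only
    rw [inv_sub_inv h₂ h₁, div_mul_eq_mul_div, mul_comm (c + t * (b - c))]
    ring
  · rw [hconst]
    refine intervalIntegral.integral_mono_on zero_le_one
      (Continuous.intervalIntegrable (by fun_prop) _ _) hint fun t ht => ?_
    have h₁ := segment_pos hc ha ht
    have h₂ := segment_pos hc hb ht
    rw [sq]
    exact div_le_div_of_nonneg_left ht.1 (mul_pos h₁ h₂)
      (mul_le_mul (segment_mem_Icc ⟨hεc, hcK⟩ ⟨hεa, haK⟩ ht).2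
        (segment_mem_Icc ⟨hεc, hcK⟩ ⟨hεb, hbK⟩ ht).2 h₂.le (hc.le.trans hcK))
  · rw [hconst]
    refine intervalIntegral.integral_mono_on zero_le_one hint
      (Continuous.intervalIntegrable (by fun_prop) _ _) fun t ht => ?_
    rw [sq]
    exact div_le_div_of_nonneg_left ht.1 (mul_pos hε hε)
      (mul_le_mul (segment_mem_Icc ⟨hεc, hcK⟩ ⟨hεa, haK⟩ ht).1
        (segment_mem_Icc ⟨hεc, hcK⟩ ⟨hεb, hbK⟩ ht).1 hε.le (segment_pos hc ha ht).le)
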